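/- Let Φ be an irreducible finite reduced crystallographic root system with base {α_s : s ∈ S}, highest root α_0 = Σ_{s∈S} m_s α_s, and write each root α = Σ_{s∈S} m_s(α) α_s. Form the affine Dynkin graph on S̃ = S ∪ {s_0}: distinct s, t ∈ S are adjacent iff α_s(α_t^∨) ≠ 0, and s_0 is adjacent to s ∈ S iff α_0(α_s^∨) ≠ 0. Let I ⊊ S̃ be a proper connected subset containing s_0, and let N(I) ⊆ S be the set of nodes of S̃ ∖ I adjacent to some node of I. Define Θ_I^+ = {α ∈ Φ : α is a nonnegative integer combination of {α_0} ∪ {−α_s : s ∈ I ∖ {s_0}}} and Θ_{I∖{s_0}}^+ = {α ∈ Φ : α is a nonnegative integer combination of {−α_s : s ∈ I ∖ {s_0}}}. Then {α ∈ Φ^+ : m_s(α) = m_s for all s ∈ N(I)} = Θ_I^+ ∖ Θ_{I∖{s_0}}^+. -/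

import Mathlib

open Module

/-- A finite reduced crystallographic root system, spanning the dual of the real vector
space `V`, together with a chosen positive system.  Roots are linear functionals on `V`,
and `coroot` associates to each root its coroot in `V`. -/
structure PosRootSystem (V : Type*) [AddCommGroup V] [Module ℝ V] where
  /-- the set of roots -/
  roots : Finset (Dual ℝ V)
  /-- the set of positive roots -/
  pos : Finset (Dual ℝ V)
  /-- the coroot of a root -/
  coroot : Dual ℝ V → V
  pos_subset : pos ⊆ roots
  mem_roots_iff : ∀ α, α ∈ roots ↔ (α ∈ pos ∨ -α ∈ pos)
  neg_not_pos : ∀ α ∈ pos, -α ∉ pos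
  add_mem_pos : ∀ α ∈ pos, ∀ β ∈ pos, α + β ∈ roots → α + β ∈ pos
  root_coroot_two : ∀ α ∈ roots, α (coroot α) = 2
  crystallographic : ∀ α ∈ roots, ∀ β ∈ roots, ∃ n : ℤ, α (coroot β) = n
  reduced : ∀ α ∈ roots, ∀ c : ℝ, c • α ∈ roots → c = 1 ∨ c = -1
  reflect_mem : ∀ α ∈ roots, ∀ β ∈ roots, α - α (coroot β) • β ∈ roots
  span_top : Submodule.span ℝ (roots : Set (Dual ℝ V)) = ⊤

namespace PosRootSystem

variable {V : Type*} [AddCommGroup V] [Module ℝ V] (P : PosRootSystem V)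

/-- `x` is a coweight: every root takes an integer value on it. -/
def IsCoweight (x : V) : Prop := ∀ α ∈ P.roots, ∃ n : ℤ, α x = n

/-- The function `f(m) = -m` for `m ≤ 0` and `f(m) = m - 1` for `m > 0`. -/
noncomputable def lenAux (m : ℝ) : ℝ := if m ≤ 0 then -m else m - 1

/-- `ℓ^S(x) = Σ_{α ∈ Φ⁺} f(α(x))`, the length of the minimal coset representative of the
translation `x` in the affine Weyl group modulo the finite Weyl group. -/
noncomputable def lS (x : V) : ℝ := ∑ α ∈ P.pos, lenAux (α x)

/-- The linear reflection `s_β x = x - β(x)·β^∨`. -/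
def sRefl (β : Dual ℝ V) (x : V) : V := x - β x • P.coroot β

/-- The affine reflection `r_β x = s_β x + β^∨` in the hyperplane `β = 1`. -/
def rRefl (β : Dual ℝ V) (x : V) : V := P.sRefl β x + P.coroot β

/-- `(α, α')` is a `β`-positive pair: `α, α'` are positive roots with `α(β^∨) < 0`
and `s_β α = α'`. -/
def IsPosPair (β α α' : Dual ℝ V) : Prop :=
  α ∈ P.pos ∧ α' ∈ P.pos ∧ α (P.coroot β) < 0 ∧ α - α (P.coroot β) • β = α'

/-- `(α, α')` is a `β`-negative pair: `α, α'` are positive roots with `s_β α = -α'`. -/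
def IsNegPair (β α α' : Dual ℝ V) : Prop :=
  α ∈ P.pos ∧ α' ∈ P.pos ∧ α - α (P.coroot β) • β = -α'

/-- The opposite sign condition for `(β, x)`: the two members of every `β`-negative pair
take values of strictly opposite signs on `x`. -/
def OppositeSignCondition (β : Dual ℝ V) (x : V) : Prop :=
  ∀ α α' : Dual ℝ V, P.IsNegPair β α α' →
    (α x < 0 ∧ 0 < α' x) ∨ (0 < α x ∧ α' x < 0)

end PosRootSystem

/-- `θ` is the highest root: `θ` is a positive root and `θ − α` is a nonnegative
combination of positive roots for every root `α`. -/
def PosRootSystem.IsHighestRoot {V : Type*} [AddCommGroup V] [Module ℝ V]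
    (P : PosRootSystem V) (θ : Module.Dual ℝ V) : Prop :=
  θ ∈ P.pos ∧ ∀ α ∈ P.roots,
    θ - α ∈ AddSubmonoid.closure (P.pos : Set (Module.Dual ℝ V))

namespace PosRootSystem

variable {V : Type*} [AddCommGroup V] [Module ℝ V] (P : PosRootSystem V)

/-- The linear endomorphisms of the dual space which map roots to roots. -/
def rootEnd : Set (Dual ℝ V →ₗ[ℝ] Dual ℝ V) := {w | ∀ α ∈ P.roots, w α ∈ P.roots}

lemma finite_rootEnd : P.rootEnd.Finite := by
  let f : P.rootEnd → P.roots → P.roots := fun w α ↦ ⟨w.1 α, w.2 α α.2⟩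
  have hf : Function.Injective f := by
    intro w w' h
    refine Subtype.ext (LinearMap.ext_on P.span_top fun α hα ↦ ?_)
    exact congrArg Subtype.val (congrFun h ⟨α, hα⟩)
  exact Set.finite_coe_iff.mp (Finite.of_injective f hf)

/-- The reflection in a root, acting on the dual space. -/
def dualRefl (β : Dual ℝ V) : Dual ℝ V →ₗ[ℝ] Dual ℝ V :=
  preReflection β (Dual.eval ℝ V (P.coroot β))

lemma dualRefl_apply (β y : Dual ℝ V) : P.dualRefl β y = y - y (P.coroot β) • β := by
  simp [dualRefl, preReflection_apply]

lemma dualRefl_self {β : Dual ℝ V} (hβ : β ∈ P.roots) : P.dualRefl β β = -β := by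
  rw [dualRefl_apply, P.root_coroot_two β hβ]
  module

lemma dualRefl_comp_self {β : Dual ℝ V} (hβ : β ∈ P.roots) :
    P.dualRefl β ∘ₗ P.dualRefl β = LinearMap.id := by
  ext1 y
  simpa [dualRefl] using
    involutive_preReflection (f := Dual.eval ℝ V (P.coroot β)) (P.root_coroot_two β hβ) y

/-- For every nonzero functional `x` there is a positive semidefinite bilinear form,
invariant under the reflections in all roots, which is positive on `x`. -/
lemma exists_invariant_form {x : Dual ℝ V} (hx : x ≠ 0) :
    ∃ B : Dual ℝ V →ₗ[ℝ] Dual ℝ V →ₗ[ℝ] ℝ, 0 < B x x ∧ (∀ y, 0 ≤ B y y) ∧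
      ∀ β ∈ P.roots, ∀ y, 2 * B y β = y (P.coroot β) * B β β := by
  obtain ⟨v, hv⟩ : ∃ v, x v ≠ 0 := by
    by_contra! h
    exact hx (LinearMap.ext h)
  let T := P.finite_rootEnd.toFinset
  let e := Dual.eval ℝ V v
  let B : Dual ℝ V →ₗ[ℝ] Dual ℝ V →ₗ[ℝ] ℝ :=
    ∑ w ∈ T, (LinearMap.mul ℝ ℝ).compl₁₂ (e ∘ₗ w) (e ∘ₗ w)
  have hB : ∀ y z, B y z = ∑ w ∈ T, w y v * w z v := by
    intro y z
    simp [B, e, LinearMap.sum_apply]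
  refine ⟨B, ?_, fun y ↦ ?_, fun β hβ y ↦ ?_⟩
  · rw [hB]
    refine Finset.sum_pos' (fun w _ ↦ mul_self_nonneg _) ⟨LinearMap.id, ?_, ?_⟩
    · simp [T, rootEnd]
    · exact mul_self_pos.mpr hv
  · rw [hB]
    exact Finset.sum_nonneg fun w _ ↦ mul_self_nonneg _
  · have hmem : ∀ w ∈ T, w ∘ₗ P.dualRefl β ∈ T := by
      intro w hw
      simp only [T, Set.Finite.mem_toFinset, rootEnd, Set.mem_ofPred_eq] at hw ⊢
      intro α hα
      rw [LinearMap.comp_apply, dualRefl_apply]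
      exact hw _ (P.reflect_mem α hα β hβ)
    have hinvol : ∀ w : Dual ℝ V →ₗ[ℝ] Dual ℝ V,
        (w ∘ₗ P.dualRefl β) ∘ₗ P.dualRefl β = w := by
      intro w
      rw [LinearMap.comp_assoc, P.dualRefl_comp_self hβ, LinearMap.comp_id]
    have hinv : B (P.dualRefl β y) (P.dualRefl β β) = B y β := by
      rw [hB, hB]
      exact Finset.sum_bij' (fun w _ ↦ w ∘ₗ P.dualRefl β) (fun w _ ↦ w ∘ₗ P.dualRefl β)
        hmem hmem (fun w _ ↦ hinvol w) (fun w _ ↦ hinvol w) (fun w _ ↦ rfl)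
    rw [P.dualRefl_self hβ, dualRefl_apply] at hinv
    simp only [map_sub, map_neg, map_smul, LinearMap.sub_apply, LinearMap.smul_apply,
      smul_eq_mul] at hinv
    linarith

variable {S : Type*} [Fintype S] {δ : S → Dual ℝ V}

/-- A nonzero nonnegative combination of roots pairs positively with the coroot of some root
occurring in it. -/
lemma exists_pos_apply_coroot (hδ : ∀ s, δ s ∈ P.roots) {g : S → ℝ} (hg : ∀ s, 0 ≤ g s)
    (hne : ∑ s, g s • δ s ≠ 0) :
    ∃ s, 0 < g s ∧ 0 < (∑ t, g t • δ t) (P.coroot (δ s)) := by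
  obtain ⟨B, hpos, hnonneg, hB⟩ := P.exists_invariant_form hne
  set x := ∑ s, g s • δ s with hx
  by_contra! h
  have hsum : B x x = ∑ s, g s * B x (δ s) := by
    conv_lhs => rw [hx, map_sum]
    simp [← hx]
  refine hpos.not_ge (hsum ▸ Finset.sum_nonpos fun s _ ↦ ?_)
  rcases (hg s).eq_or_lt with h0 | h0
  · simp [← h0]
  · have := mul_nonpos_of_nonpos_of_nonneg (h s h0) (hnonneg (δ s))
    have := hB (δ s) (hδ s) x
    exact mul_nonpos_of_nonneg_of_nonpos h0.le (by linarith)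

lemma sum_sub_smul (a b : S → ℝ) (δ : S → Dual ℝ V) :
    ∑ s, (a s - b s) • δ s = ∑ s, a s • δ s - ∑ s, b s • δ s := by
  rw [← Finset.sum_sub_distrib]
  exact Finset.sum_congr rfl fun s _ ↦ by module

lemma sum_neg_smul (a : S → ℝ) (δ : S → Dual ℝ V) :
    ∑ s, (-a s) • δ s = -∑ s, a s • δ s := by
  rw [← Finset.sum_neg_distrib]
  exact Finset.sum_congr rfl fun s _ ↦ by module

/-- Integral coordinates with respect to a linearly independent family are unique. -/
lemma int_coeff_unique (hind : LinearIndependent ℝ δ) {a b : S → ℤ}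
    (h : ∑ s, (a s : ℝ) • δ s = ∑ s, (b s : ℝ) • δ s) (s : S) : a s = b s := by
  exact_mod_cast Fintype.linearIndependent_iffₛ.mp hind (fun s ↦ (a s : ℝ)) (fun s ↦ (b s : ℝ)) h s

variable {coeff : Dual ℝ V → S → ℤ}

lemma exists_nonneg_coeff_of_mem_closure (hcoeff : ∀ α ∈ P.roots, α = ∑ s, (coeff α s : ℝ) • δ s)
    (hcoeffpos : ∀ α ∈ P.pos, ∀ s, 0 ≤ coeff α s) {y : Dual ℝ V}
    (hy : y ∈ AddSubmonoid.closure (P.pos : Set (Dual ℝ V))) :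
    ∃ g : S → ℤ, (∀ s, 0 ≤ g s) ∧ y = ∑ s, (g s : ℝ) • δ s := by
  induction hy using AddSubmonoid.closure_induction with
  | mem α hα => exact ⟨coeff α, hcoeffpos α hα, hcoeff α (P.pos_subset hα)⟩
  | zero => exact ⟨0, fun _ ↦ le_rfl, by simp⟩
  | add y z _ _ hy hz =>
    obtain ⟨g, hg, rfl⟩ := hy
    obtain ⟨h, hh, rfl⟩ := hz
    refine ⟨g + h, fun s ↦ add_nonneg (hg s) (hh s), ?_⟩
    simp [add_smul, Finset.sum_add_distrib]

lemma IsHighestRoot.coeff_le {P : PosRootSystem V} {θ : Dual ℝ V} (hθ : P.IsHighestRoot θ)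
    (hind : LinearIndependent ℝ δ) (hcoeff : ∀ α ∈ P.roots, α = ∑ s, (coeff α s : ℝ) • δ s)
    (hcoeffpos : ∀ α ∈ P.pos, ∀ s, 0 ≤ coeff α s) {α : Dual ℝ V} (hα : α ∈ P.roots) (s : S) :
    coeff α s ≤ coeff θ s := by
  obtain ⟨g, hg, h⟩ := P.exists_nonneg_coeff_of_mem_closure hcoeff hcoeffpos (hθ.2 α hα)
  have hsum : ∑ s, (coeff θ s : ℝ) • δ s = ∑ s, ((coeff α s + g s : ℤ) : ℝ) • δ s := by
    simp only [Int.cast_add, add_smul, Finset.sum_add_distrib]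
    rw [← h, ← hcoeff α hα, ← hcoeff θ (P.pos_subset hθ.1)]
    abel
  have := int_coeff_unique hind hsum s
  have := hg s
  lia

lemma coeff_simple [DecidableEq S] (hind : LinearIndependent ℝ δ)
    (hcoeff : ∀ α ∈ P.roots, α = ∑ s, (coeff α s : ℝ) • δ s) {t : S} (ht : δ t ∈ P.roots)
    (s : S) : coeff (δ t) s = if s = t then 1 else 0 := by
  refine int_coeff_unique hind (b := fun s ↦ if s = t then 1 else 0) ?_ s
  rw [← hcoeff _ ht]
  simp

lemma coeff_add_zsmul_simple [DecidableEq S] (hind : LinearIndependent ℝ δ)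
    (hcoeff : ∀ α ∈ P.roots, α = ∑ s, (coeff α s : ℝ) • δ s) {α : Dual ℝ V} (hα : α ∈ P.roots)
    {k : ℤ} {t : S} (h : α + (k : ℝ) • δ t ∈ P.roots) (s : S) :
    coeff (α + (k : ℝ) • δ t) s = coeff α s + if s = t then k else 0 := by
  refine int_coeff_unique hind (b := fun s ↦ coeff α s + if s = t then k else 0) ?_ s
  rw [← hcoeff _ h]
  simp [add_smul, Finset.sum_add_distrib, ← hcoeff α hα]

/-- Let `J` be a set of simple roots orthogonal to the highest root and to all simple roots
outside `J ∪ N`. A root whose coefficients on `N` agree with those of the highest root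
also agrees with it on `J`. -/
lemma IsHighestRoot.coeff_eq_of_orthogonal {P : PosRootSystem V} {θ : Dual ℝ V}
    (hθ : P.IsHighestRoot θ) (hδ : ∀ s, δ s ∈ P.roots) (hind : LinearIndependent ℝ δ)
    (hcoeff : ∀ α ∈ P.roots, α = ∑ s, (coeff α s : ℝ) • δ s)
    (hcoeffpos : ∀ α ∈ P.pos, ∀ s, 0 ≤ coeff α s) {J N : Set S} (hJN : Disjoint J N)
    (hθJ : ∀ s ∈ J, θ (P.coroot (δ s)) = 0)
    (hJ : ∀ s ∈ J, ∀ t, t ∉ J → t ∉ N → δ t (P.coroot (δ s)) = 0)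
    {α : Dual ℝ V} (hα : α ∈ P.roots) (hN : ∀ s ∈ N, coeff α s = coeff θ s) :
    ∀ s ∈ J, coeff α s = coeff θ s := by
  classical
  let gap : Dual ℝ V → S → ℤ := fun α s ↦ if s ∈ J then coeff θ s - coeff α s else 0
  have hgap_nonneg : ∀ α ∈ P.roots, ∀ s, 0 ≤ gap α s := by
    intro α hα s
    have := hθ.coeff_le hind hcoeff hcoeffpos hα s
    simp only [gap]
    split_ifs <;> lia
  have hpair : ∀ α ∈ P.roots, (∀ s ∈ N, coeff α s = coeff θ s) → ∀ s ∈ J,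
      (∑ t, (gap α t : ℝ) • δ t) (P.coroot (δ s)) = -α (P.coroot (δ s)) := by
    intro α hα hN s hs
    have hsub : θ - α = ∑ t, ((coeff θ t - coeff α t : ℤ) : ℝ) • δ t := by
      simp only [Int.cast_sub]
      rw [sum_sub_smul, ← hcoeff α hα, ← hcoeff θ (P.pos_subset hθ.1)]
    have heq : (∑ t, (gap α t : ℝ) • δ t) (P.coroot (δ s)) = (θ - α) (P.coroot (δ s)) := by
      rw [hsub, LinearMap.sum_apply, LinearMap.sum_apply]
      refine Finset.sum_congr rfl fun t _ ↦ ?_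
      by_cases htJ : t ∈ J
      · simp [gap, htJ]
      · by_cases htN : t ∈ N
        · simp [gap, htJ, hN t htN]
        · simp [hJ s hs t htJ htN]
    rw [heq, LinearMap.sub_apply, hθJ s hs, zero_sub]
  induction hn : (∑ s, gap α s).toNat using Nat.strong_induction_on generalizing α with
  | _ n ih =>
    by_cases hx : ∑ s, (gap α s : ℝ) • δ s = 0
    · intro s hs
      have := int_coeff_unique hind (a := gap α) (b := 0) (by simpa using hx) s
      simp only [gap, hs, if_true, Pi.zero_apply] at this
      lia
    · exfalso
      obtain ⟨s, hgs, hs⟩ := P.exists_pos_apply_coroot hδ (g := fun s ↦ (gap α s : ℝ))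
        (fun s ↦ by exact_mod_cast hgap_nonneg α hα s) hx
      have hsJ : s ∈ J := by
        by_contra h
        simp [gap, h] at hgs
      rw [hpair α hα hN s hsJ] at hs
      obtain ⟨k, hk⟩ := P.crystallographic α hα (δ s) (hδ s)
      have hk0 : 0 < -k := by
        rw [hk] at hs
        exact_mod_cast hs
      have hα' : α + ((-k : ℤ) : ℝ) • δ s ∈ P.roots := by
        have := P.reflect_mem α hα (δ s) (hδ s)
        convert this using 1
        rw [hk, Int.cast_neg]
        module
      have hc := P.coeff_add_zsmul_simple hind hcoeff hα hα'
      have hN' : ∀ t ∈ N, coeff (α + ((-k : ℤ) : ℝ) • δ s) t = coeff θ t := by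
        intro t ht
        have hts : t ≠ s := fun h ↦ Set.disjoint_left.mp hJN hsJ (h ▸ ht)
        rw [hc, if_neg hts, add_zero, hN t ht]
      have hlt : ∑ t, gap (α + ((-k : ℤ) : ℝ) • δ s) t < ∑ t, gap α t := by
        refine Finset.sum_lt_sum (fun t _ ↦ ?_) ⟨s, Finset.mem_univ s, ?_⟩
        · simp only [gap, hc]
          split_ifs <;> lia
        · simp only [gap, hc, hsJ, if_true]
          lia
      have h0 := Finset.sum_nonneg fun t (_ : t ∈ Finset.univ) ↦ hgap_nonneg _ hα' t
      have hJ' := ih _ (by lia) hα' hN' rfl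
      have hgap0 : ∀ t, gap (α + ((-k : ℤ) : ℝ) • δ s) t = 0 := by
        intro t
        by_cases ht : t ∈ J
        · simp only [gap, ht, if_true, hJ' t ht, sub_self]
        · simp only [gap, ht, if_false]
      have hzero := hpair _ hα' hN' s hsJ
      simp only [hgap0, Int.cast_zero, zero_smul, Finset.sum_const_zero,
        LinearMap.zero_apply] at hzero
      simp only [LinearMap.add_apply, LinearMap.smul_apply, hk, P.root_coroot_two (δ s) (hδ s),
        smul_eq_mul, Int.cast_neg] at hzero
      have : (k : ℝ) = 0 := by linarith
      have : k = 0 := by exact_mod_cast this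
      lia

end PosRootSystem

/-- For a proper connected subset `I` of the affine Dynkin graph containing the affine
node `s₀ = none`, the set of positive roots `α` with `m_s(α) = m_s(α₀)` for all
`s ∈ N(I)` equals `Θ_I^+ ∖ Θ_{I∖{s₀}}^+`. -/
theorem cpo_roots_eq {V : Type*} [AddCommGroup V] [Module ℝ V] (P : PosRootSystem V)
    {S : Type*} [Fintype S] [DecidableEq S]
    -- the base (simple roots) of `Φ`, indexed by `S`
    (δ : S → Module.Dual ℝ V)
    (hδpos : ∀ s, δ s ∈ P.pos)
    (hind : LinearIndependent ℝ δ)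
    -- the coefficients `m_s(α)` of roots with respect to the base
    (coeff : Module.Dual ℝ V → S → ℤ)
    (hcoeff : ∀ α ∈ P.roots, α = ∑ s, (coeff α s : ℝ) • δ s)
    (hcoeffpos : ∀ α ∈ P.pos, ∀ s, 0 ≤ coeff α s)
    -- the highest root `α₀`
    (θ : Module.Dual ℝ V) (hθ : P.IsHighestRoot θ)
    -- the affine Dynkin graph on `S̃ = S ∪ {s₀}`, with `s₀ = none`
    (G : SimpleGraph (Option S))
    (hG : ∀ a b : Option S, G.Adj a b ↔ a ≠ b ∧
      ((a.elim θ δ) (P.coroot (b.elim θ δ)) ≠ 0 ∨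
        (b.elim θ δ) (P.coroot (a.elim θ δ)) ≠ 0))
    -- a proper connected subset `I ⊊ S̃` containing `s₀`
    (I : Set (Option S)) (h0I : none ∈ I) (hproper : I ≠ Set.univ)
    (hconn : (G.induce I).Connected)
    -- the neighbour set `N(I) ⊆ S`
    (NI : Set S)
    (hNI : ∀ s : S, s ∈ NI ↔ (some s ∉ I ∧ ∃ t ∈ I, G.Adj (some s) t)) :
    {α : Module.Dual ℝ V | α ∈ P.pos ∧ ∀ s ∈ NI, coeff α s = coeff θ s}
      = {α : Module.Dual ℝ V | α ∈ P.roots ∧ ∃ c : Option S → ℕ,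
            (∀ a, c a ≠ 0 → a ∈ I) ∧
            α = (c none : ℝ) • θ - ∑ s : S, ((c (some s) : ℝ)) • δ s}
        \ {α : Module.Dual ℝ V | α ∈ P.roots ∧ ∃ c : Option S → ℕ,
            (∀ a, c a ≠ 0 → a ∈ I ∧ a ≠ none) ∧
            α = - ∑ s : S, ((c (some s) : ℝ)) • δ s} := by
  have hδ : ∀ s, δ s ∈ P.roots := fun s ↦ P.pos_subset (hδpos s)
  have hθr : θ ∈ P.roots := P.pos_subset hθ.1
  have hle : ∀ α ∈ P.roots, ∀ s, coeff α s ≤ coeff θ s :=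
    fun α hα s ↦ hθ.coeff_le hind hcoeff hcoeffpos hα s
  have hne : ∀ α ∈ P.roots, α ≠ 0 := by
    rintro α hα rfl
    simpa using P.root_coroot_two 0 hα
  ext α
  simp only [Set.mem_ofPred_eq, Set.mem_sdiff]
  constructor
  · rintro ⟨hα, hN⟩
    have hαr := P.pos_subset hα
    have hout : ∀ s, some s ∉ I → coeff α s = coeff θ s := by
      have horth : ∀ s, some s ∉ I → s ∉ NI → ∀ a ∈ I,
          (a.elim θ δ) (P.coroot (δ s)) = 0 := by
        intro s hs hsN a ha
        by_contra h
        refine hsN ((hNI s).mpr ⟨hs, a, ha, (hG _ _).mpr ⟨?_, Or.inr h⟩⟩)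
        rintro rfl
        exact hs ha
      have hJ := hθ.coeff_eq_of_orthogonal hδ hind hcoeff hcoeffpos
        (J := {s | some s ∉ I ∧ s ∉ NI}) (N := NI) (Set.disjoint_left.mpr fun s hs ↦ hs.2)
        (fun s hs ↦ horth s hs.1 hs.2 none h0I)
        (fun s hs t htJ htN ↦ horth s hs.1 hs.2 (some t) (by
          by_contra h
          exact htJ ⟨h, htN⟩)) hαr hN
      intro s hs
      by_cases hsN : s ∈ NI
      · exact hN s hsN
      · exact hJ s ⟨hs, hsN⟩
    refine ⟨⟨hαr, fun a ↦ a.elim 1 fun s ↦ (coeff θ s - coeff α s).toNat, ?_, ?_⟩, ?_⟩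
    · rintro (_ | s) ha
      · exact h0I
      · by_contra hs
        simp [hout s hs] at ha
    · have hcast : ∀ s, (((coeff θ s - coeff α s).toNat : ℕ) : ℝ)
          = (coeff θ s : ℝ) - (coeff α s : ℝ) := by
        intro s
        have h : (((coeff θ s - coeff α s).toNat : ℕ) : ℤ) = coeff θ s - coeff α s :=
          Int.toNat_of_nonneg (sub_nonneg.mpr (hle α hαr s))
        exact_mod_cast congrArg (Int.cast : ℤ → ℝ) h
      simp only [Option.elim, hcast]
      rw [PosRootSystem.sum_sub_smul, ← hcoeff θ hθr, ← hcoeff α hαr]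
      simp
    · rintro ⟨-, c, -, hc⟩
      have hsum : ∑ s, (coeff α s : ℝ) • δ s = ∑ s, ((-(c (some s) : ℤ) : ℤ) : ℝ) • δ s := by
        simp only [Int.cast_neg, Int.cast_natCast]
        rw [PosRootSystem.sum_neg_smul, ← hcoeff α hαr, hc]
      refine hne α hαr ?_
      rw [hcoeff α hαr]
      refine Finset.sum_eq_zero fun s _ ↦ ?_
      have h₁ := PosRootSystem.int_coeff_unique hind hsum s
      have h₂ := hcoeffpos α hα s
      have h₃ : coeff α s = 0 := by lia
      simp [h₃]
  · rintro ⟨⟨hαr, c, hcI, hc⟩, hnot⟩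
    have hc0 : c none ≠ 0 := by
      intro h0
      refine hnot ⟨hαr, c, fun a ha ↦ ⟨hcI a ha, ?_⟩, by simpa [h0] using hc⟩
      rintro rfl
      exact ha h0
    have hcoe : ∀ s, some s ∉ I → coeff α s = c none * coeff θ s := by
      intro s hs
      have hsum : ∑ s, (coeff α s : ℝ) • δ s
          = ∑ s, ((c none * coeff θ s - c (some s) : ℤ) : ℝ) • δ s := by
        simp only [Int.cast_sub, Int.cast_mul, Int.cast_natCast]
        rw [PosRootSystem.sum_sub_smul, ← hcoeff α hαr]
        simp only [mul_smul]
        rw [← Finset.smul_sum, ← hcoeff θ hθr, ← hc]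
      have hcs : c (some s) = 0 := by
        by_contra h
        exact hs (hcI _ h)
      simpa [hcs] using PosRootSystem.int_coeff_unique hind hsum s
    have hθpos : ∀ s, 1 ≤ coeff θ s := by
      intro s
      have h := hle (δ s) (hδ s) s
      rwa [P.coeff_simple hind hcoeff (hδ s), if_pos rfl] at h
    obtain ⟨s, hs⟩ : ∃ s, some s ∉ I := by
      obtain ⟨_ | s, hs⟩ := (Set.ne_univ_iff_exists_notMem I).mp hproper
      · exact absurd h0I hs
      · exact ⟨s, hs⟩
    have hc1 : c none = 1 := by
      have h₁ := hle α hαr s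
      rw [hcoe s hs] at h₁
      have h₂ : (c none : ℤ) ≤ 1 := by
        by_contra! h
        nlinarith [hθpos s]
      lia
    simp only [hc1, Nat.cast_one, one_mul] at hcoe
    refine ⟨?_, fun t ht ↦ hcoe t ((hNI t).mp ht).1⟩
    rcases (P.mem_roots_iff α).mp hαr with h | h
    · exact h
    · exfalso
      have hsum : ∑ s, (coeff (-α) s : ℝ) • δ s = ∑ s, ((-coeff α s : ℤ) : ℝ) • δ s := by
        simp only [Int.cast_neg]
        rw [PosRootSystem.sum_neg_smul, ← hcoeff _ (P.pos_subset h), ← hcoeff α hαr]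
      have h₁ := PosRootSystem.int_coeff_unique hind hsum s
      have h₂ := hcoeffpos _ h s
      have h₃ := hθpos s
      have h₄ := hcoe s hs
      lia
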